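/- (Generalised Blaschke–Santaló inequality) Let n ≥ 1, and let α, β > 0 satisfy n/α + 1/β ≥ 1 and 1/α + n/β ≥ 1. Then there is a constant C = C(n,α,β) such that for every convex body Ω in ℝ^{n+1} there exists z in the interior of Ω with (∫_{S^n} r_z^α dσ)^{1/α} · (∫_{S^n} (r_z^*)^β dσ)^{1/β} ≤ C, where r_z is the radial function of Ω with center z and r_z^* is the radial function of the polar body Ω_z^* with center z. -/

import Mathlib

open MeasureTheory Metric

/-- The radial function of `Ω` with respect to the centre `z`:
`r_z(x) = sup {λ > 0 : z + λx ∈ Ω}`. -/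
noncomputable def radial {n : ℕ} (Ω : Set (EuclideanSpace ℝ (Fin (n+1))))
    (z x : EuclideanSpace ℝ (Fin (n+1))) : ℝ :=
  sSup {l : ℝ | 0 < l ∧ z + l • x ∈ Ω}

/-- The dual body of `Ω` with respect to `z`:
`Ω_z^* = {w : (w - z)·(x - z) ≤ 1 for all x ∈ Ω}`. -/
def dualBody {n : ℕ} (Ω : Set (EuclideanSpace ℝ (Fin (n+1))))
    (z : EuclideanSpace ℝ (Fin (n+1))) : Set (EuclideanSpace ℝ (Fin (n+1))) :=
  {w | ∀ x ∈ Ω, ∑ i, (w i - z i) * (x i - z i) ≤ 1}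

/-- The standard surface measure `σ` on the unit sphere `S^n ⊆ ℝ^(n+1)`. -/
noncomputable def sphereMeasure (n : ℕ) :
    Measure (sphere (0 : EuclideanSpace ℝ (Fin (n+1))) 1) :=
  (volume : Measure (EuclideanSpace ℝ (Fin (n+1)))).toSphere

theorem integrableOn_abs_rpow_neg {t : ℝ} (ht : t < 1) {M : ℝ} (hM : 0 ≤ M) :
    IntegrableOn (fun x : ℝ => |x| ^ (-t)) (Set.Icc (-M) M) := by
  have h0 : IntegrableOn (fun x : ℝ => |x| ^ (-t)) (Set.Icc 0 M) := by
    have := (intervalIntegral.intervalIntegrable_rpow' (a := 0) (b := M)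
      (show (-1 : ℝ) < -t by linarith))
    rw [intervalIntegrable_iff_integrableOn_Icc_of_le hM] at this
    refine this.congr_fun (fun x hx => ?_) measurableSet_Icc
    simp [abs_of_nonneg hx.1]
  have h1 : IntegrableOn (fun x : ℝ => |x| ^ (-t)) (Set.Icc (-M) 0) := by
    have := h0.comp_neg
    simpa using this
  rw [← Set.Icc_union_Icc_eq_Icc (neg_nonpos.2 hM) hM]
  exact h1.union h0

/-- A one-dimensional integral of `(1 + (l x)²) ^ (-s/2)` over a bounded interval decays like
`l ^ (-t)` whenever `0 ≤ t ≤ 1` and `t < s`. -/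
theorem exists_setIntegral_one_add_sq_rpow_le {s t : ℝ} (ht0 : 0 ≤ t) (ht1 : t ≤ 1) (hts : t < s)
    {M : ℝ} (hM : 0 ≤ M) : ∃ C : ℝ, 0 ≤ C ∧ ∀ l : ℝ, 0 < l →
      ∫ x in Set.Icc (-M) M, (1 + (l * x) ^ 2) ^ (-(s / 2)) ≤ C * l ^ (-t) := by
  rcases lt_or_eq_of_le ht1 with ht | rfl
  · refine ⟨∫ x in Set.Icc (-M) M, |x| ^ (-t),
      integral_nonneg fun x => by positivity, fun l hl => ?_⟩
    rw [mul_comm, ← integral_const_mul]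
    refine integral_mono_of_nonneg (.of_forall fun x => by positivity)
      ((integrableOn_abs_rpow_neg ht hM).const_mul _) ?_
    have hne : ∀ᵐ x : ℝ ∂(volume.restrict (Set.Icc (-M) M)), x ≠ 0 :=
      ae_restrict_of_ae (by simp [ae_iff])
    filter_upwards [hne] with x hx
    have hpos : 0 < |l * x| := by positivity
    calc (1 + (l * x) ^ 2) ^ (-(s / 2)) ≤ (1 + (l * x) ^ 2) ^ (-(t / 2)) :=
          Real.rpow_le_rpow_of_exponent_le (by nlinarith [sq_nonneg (l * x)]) (by linarith)
      _ ≤ (|l * x| ^ 2) ^ (-(t / 2)) :=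
          Real.rpow_le_rpow_of_nonpos (by positivity) (by rw [sq_abs]; linarith) (by linarith)
      _ = |l * x| ^ (-t) := by
          rw [← Real.rpow_natCast, ← Real.rpow_mul (abs_nonneg _)]
          congr 1
          push_cast
          ring
      _ = l ^ (-t) * |x| ^ (-t) := by
          rw [abs_mul, abs_of_pos hl, Real.mul_rpow hl.le (abs_nonneg _)]
  · have hint : Integrable (fun y : ℝ => (1 + y ^ 2) ^ (-(s / 2))) := by
      have := integrable_rpow_neg_one_add_norm_sq (E := ℝ) (μ := volume) (r := s) (by simpa using hts)
      simpa [neg_div] using this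
    refine ⟨∫ y : ℝ, (1 + y ^ 2) ^ (-(s / 2)), integral_nonneg fun x => by positivity,
      fun l hl => ?_⟩
    have hcomp := Measure.integral_comp_mul_left (fun y : ℝ => (1 + y ^ 2) ^ (-(s / 2))) l
    calc _ ≤ ∫ x : ℝ, (1 + (l * x) ^ 2) ^ (-(s / 2)) :=
          setIntegral_le_integral (hint.comp_mul_left' hl.ne') (.of_forall fun x => by positivity)
      _ = _ := by
          rw [hcomp, abs_of_pos (inv_pos.2 hl), Real.rpow_neg_one, smul_eq_mul, mul_comm]

/-- The part of the cube `[-2, 2]^ι` where the coordinate `j` is at least comparable to `1`. -/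
def cubeSlab {ι : Type*} [Fintype ι] (j : ι) : Set (ι → ℝ) :=
  {y | (∀ i, y i ∈ Set.Icc (-2 : ℝ) 2) ∧ 1 ≤ Fintype.card ι * (y j) ^ 2}

theorem isCompact_cubeSlab {ι : Type*} [Fintype ι] (j : ι) : IsCompact (cubeSlab j) := by
  have h1 : IsCompact (Set.univ.pi fun _ : ι => Set.Icc (-2 : ℝ) 2) :=
    isCompact_univ_pi fun _ => isCompact_Icc
  have h2 : IsClosed {y : ι → ℝ | 1 ≤ Fintype.card ι * (y j) ^ 2} :=
    isClosed_le continuous_const (by fun_prop)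
  convert h1.inter_right h2 using 1
  ext y
  simp only [cubeSlab, Set.mem_inter_iff, Set.mem_pi, Set.mem_univ, true_implies,
    Set.mem_ofPred_eq]

/-- On a slab, the ellipsoidal norm is bounded below by a product of one-variable factors. -/
theorem prod_one_add_sq_rpow_le {ι : Type*} [Fintype ι] [DecidableEq ι] {τ : ι → ℝ}
    (hτ : ∀ i, 0 ≤ τ i) {j : ι} (hτs : ∑ i ∈ Finset.univ.erase j, τ i ≤ 1)
    {a : ι → ℝ} (ha : ∀ i, 0 < a i) {y : ι → ℝ} (hy : y ∈ cubeSlab j) :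
    (a j) ^ 2 / Fintype.card ι *
      ∏ i ∈ Finset.univ.erase j, (1 + (a i / a j * y i) ^ 2) ^ τ i ≤ ∑ i, (a i * y i) ^ 2 := by
  have hcard : (1 : ℝ) ≤ Fintype.card ι := by
    exact_mod_cast Fintype.card_pos_iff.2 ⟨j⟩
  have hc0 : (0 : ℝ) < Fintype.card ι := by linarith
  set W := 1 + ∑ i ∈ Finset.univ.erase j, (a i / a j * y i) ^ 2 with hW
  have hS : 0 ≤ ∑ i ∈ Finset.univ.erase j, (a i / a j * y i) ^ 2 :=
    Finset.sum_nonneg fun i _ => sq_nonneg _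
  have hW1 : 1 ≤ W := by linarith
  have hprod : ∏ i ∈ Finset.univ.erase j, (1 + (a i / a j * y i) ^ 2) ^ τ i ≤ W := by
    calc _ ≤ ∏ i ∈ Finset.univ.erase j, W ^ τ i := by
          refine Finset.prod_le_prod (fun i _ => by positivity) fun i hi => ?_
          refine Real.rpow_le_rpow (by positivity) ?_ (hτ i)
          have := Finset.single_le_sum (f := fun i => (a i / a j * y i) ^ 2)
            (fun i _ => sq_nonneg _) hi
          linarith
      _ = W ^ ∑ i ∈ Finset.univ.erase j, τ i := by
          rw [Real.rpow_sum_of_pos (by linarith)]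
      _ ≤ W ^ (1 : ℝ) := Real.rpow_le_rpow_of_exponent_le hW1 hτs
      _ = W := Real.rpow_one W
  refine (mul_le_mul_of_nonneg_left hprod (by positivity)).trans ?_
  rw [← Finset.add_sum_erase _ _ (Finset.mem_univ j), hW, mul_add, mul_one, Finset.mul_sum]
  refine add_le_add ?_ (Finset.sum_le_sum fun i _ => ?_)
  · rw [div_le_iff₀ hc0, mul_pow]
    have := hy.2
    nlinarith [sq_nonneg (a j)]
  · have haj := (ha j).ne'
    have : (a j) ^ 2 / Fintype.card ι * (a i / a j * y i) ^ 2
        = (a i * y i) ^ 2 / Fintype.card ι := by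
      field_simp
    rw [this]
    exact div_le_self (sq_nonneg _) hcard

/-- The monomial bound for the integral of a negative power of an ellipsoidal norm over a slab. -/
theorem exists_setIntegral_cubeSlab_le {ι : Type*} [Fintype ι] {γ : ℝ} (hγ : 0 < γ) {θ : ι → ℝ}
    (hθ : ∀ i, 0 ≤ θ i) (hθs : ∑ i, θ i = 1) {j : ι} (hj : 0 < θ j)
    (hθγ : ∀ i, i ≠ j → γ * θ i ≤ 1) :
    ∃ C : ℝ, 0 ≤ C ∧ ∀ a : ι → ℝ, (∀ i, 0 < a i) →
      ∫ y in cubeSlab j, (∑ i, (a i * y i) ^ 2) ^ (-(γ / 2)) ≤ C * ∏ i, a i ^ (-(γ * θ i)) := by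
  classical
  have hcard : (1 : ℝ) ≤ Fintype.card ι := by
    exact_mod_cast Fintype.card_pos_iff.2 ⟨j⟩
  have hc0 : (0 : ℝ) < Fintype.card ι := by linarith
  set τ : ι → ℝ := fun i => θ i + θ j / Fintype.card ι with hτ
  have hτ0 : ∀ i, 0 ≤ τ i := fun i => add_nonneg (hθ i) (by positivity)
  have hθe : ∑ i ∈ Finset.univ.erase j, θ i = 1 - θ j := by
    rw [← hθs, ← Finset.add_sum_erase _ _ (Finset.mem_univ j)]
    ring
  have hτs : ∑ i ∈ Finset.univ.erase j, τ i ≤ 1 := by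
    have hle : ∑ i ∈ Finset.univ.erase j, τ i ≤
        ∑ i ∈ Finset.univ.erase j, θ i + ∑ i : ι, θ j / Fintype.card ι := by
      rw [Finset.sum_add_distrib]
      gcongr
      exact Finset.erase_subset _ _
    have : ∑ i : ι, θ j / Fintype.card ι = θ j := by
      rw [Finset.sum_const, Finset.card_univ, nsmul_eq_mul]
      field_simp
    linarith
  have h1d : ∀ i, ∃ C : ℝ, 0 ≤ C ∧ (i ≠ j → ∀ l : ℝ, 0 < l →
      ∫ x in Set.Icc (-2 : ℝ) 2, (1 + (l * x) ^ 2) ^ (-(γ * τ i / 2)) ≤ C * l ^ (-(γ * θ i))) := by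
    intro i
    by_cases hij : i = j
    · exact ⟨0, le_rfl, fun h => (h hij).elim⟩
    · obtain ⟨C, hC, h⟩ := exists_setIntegral_one_add_sq_rpow_le
        (s := γ * τ i) (t := γ * θ i) (mul_nonneg hγ.le (hθ i)) (hθγ i hij)
        (mul_lt_mul_of_pos_left (lt_add_of_pos_right _ (by positivity)) hγ)
        (M := 2) (by norm_num)
      exact ⟨C, hC, fun _ => h⟩
  choose c hc0' hc using h1d
  refine ⟨(Fintype.card ι : ℝ) ^ (γ / 2) * (4 * ∏ i ∈ Finset.univ.erase j, c i),
    mul_nonneg (by positivity) (mul_nonneg (by norm_num) (Finset.prod_nonneg fun i _ => hc0' i)),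
    fun a ha => ?_⟩
  set f : ι → ℝ → ℝ := fun i => if i = j then (Set.Icc (-2 : ℝ) 2).indicator 1 else
    (Set.Icc (-2 : ℝ) 2).indicator fun x => (1 + (a i / a j * x) ^ 2) ^ (-(γ * τ i / 2)) with hf
  have hfint : ∀ i, Integrable (f i) := by
    intro i
    simp only [hf]
    split_ifs
    · exact (integrable_indicator_iff measurableSet_Icc).2
        (continuous_const.integrableOn_Icc)
    · refine (integrable_indicator_iff measurableSet_Icc).2 (Continuous.integrableOn_Icc ?_)
      refine Continuous.rpow_const (by fun_prop) fun x => Or.inl ?_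
      positivity
  have hfnn : ∀ i x, 0 ≤ f i x := by
    intro i x
    simp only [hf]
    split_ifs
    · exact Set.indicator_nonneg (fun _ _ => zero_le_one) x
    · exact Set.indicator_nonneg (fun _ _ => by positivity) x
  set A : ℝ := ((a j) ^ 2 / Fintype.card ι) ^ (-(γ / 2)) with hA
  have haj := ha j
  have hbound : ∫ y in cubeSlab j, (∑ i, (a i * y i) ^ 2) ^ (-(γ / 2)) ≤
      ∫ y : ι → ℝ, A * ∏ i, f i (y i) := by
    rw [← integral_indicator (isCompact_cubeSlab j).measurableSet]
    refine integral_mono_of_nonneg (.of_forall fun y => Set.indicator_nonneg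
      (fun y _ => Real.rpow_nonneg (Finset.sum_nonneg fun i _ => sq_nonneg _) _) y)
      ((Integrable.fintype_prod hfint).const_mul _) (.of_forall fun y => ?_)
    by_cases hy : y ∈ cubeSlab j
    · simp only [Set.indicator_of_mem hy]
      have hpos : 0 < (a j) ^ 2 / Fintype.card ι *
          ∏ i ∈ Finset.univ.erase j, (1 + (a i / a j * y i) ^ 2) ^ τ i :=
        mul_pos (by positivity) (Finset.prod_pos fun i _ => by positivity)
      refine (Real.rpow_le_rpow_of_nonpos hpos (prod_one_add_sq_rpow_le hτ0 hτs ha hy)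
        (by linarith)).trans_eq ?_
      rw [Real.mul_rpow (by positivity) (Finset.prod_nonneg fun i _ => by positivity),
        ← Real.finsetProd_rpow _ _ (fun i _ => by positivity),
        ← Finset.mul_prod_erase _ _ (Finset.mem_univ j)]
      have hjj : f j (y j) = 1 := by simp only [hf, if_true, Set.indicator_of_mem (hy.1 j)]; rfl
      rw [hjj, one_mul]
      congr 1
      refine Finset.prod_congr rfl fun i hi => ?_
      simp only [hf, if_neg (Finset.ne_of_mem_erase hi), Set.indicator_of_mem (hy.1 i)]
      rw [← Real.rpow_mul (by positivity)]
      congr 1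
      ring
    · simp only [Set.indicator_of_notMem hy]
      exact mul_nonneg (by positivity) (Finset.prod_nonneg fun i _ => hfnn i _)
  refine hbound.trans ?_
  rw [integral_const_mul, integral_fintype_prod_volume_eq_prod,
    ← Finset.mul_prod_erase _ _ (Finset.mem_univ j)]
  have hj4 : ∫ x, f j x = 4 := by
    simp only [hf, if_true]
    rw [integral_indicator measurableSet_Icc]
    simp
    norm_num
  have hother : ∏ i ∈ Finset.univ.erase j, ∫ x, f i x ≤
      ∏ i ∈ Finset.univ.erase j, (c i * (a i / a j) ^ (-(γ * θ i))) := by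
    refine Finset.prod_le_prod (fun i _ => integral_nonneg (hfnn i)) fun i hi => ?_
    have hij := Finset.ne_of_mem_erase hi
    simp only [hf, if_neg hij]
    rw [integral_indicator measurableSet_Icc]
    exact hc i hij _ (div_pos (ha i) haj)
  have hAval : A = (Fintype.card ι : ℝ) ^ (γ / 2) * a j ^ (-γ) := by
    rw [hA, Real.div_rpow (by positivity) hc0.le, Real.rpow_neg hc0.le, div_inv_eq_mul, mul_comm,
      ← Real.rpow_natCast, ← Real.rpow_mul haj.le]
    congr 2
    push_cast
    ring
  have hscale : a j ^ (-γ) * ∏ i ∈ Finset.univ.erase j, (a i / a j) ^ (-(γ * θ i)) =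
      ∏ i, a i ^ (-(γ * θ i)) := by
    have h1 : ∏ i ∈ Finset.univ.erase j, (a i / a j) ^ (-(γ * θ i)) =
        (∏ i ∈ Finset.univ.erase j, a i ^ (-(γ * θ i))) * a j ^ (γ * (1 - θ j)) := by
      rw [← hθe, Finset.mul_sum, Real.rpow_sum_of_pos haj, ← Finset.prod_mul_distrib]
      refine Finset.prod_congr rfl fun i _ => ?_
      rw [Real.div_rpow (ha i).le haj.le, Real.rpow_neg haj.le, div_inv_eq_mul]
    rw [h1, ← Finset.mul_prod_erase _ _ (Finset.mem_univ j), mul_left_comm, ← Real.rpow_add haj,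
      mul_comm]
    congr 2
    ring
  rw [hj4, hAval, ← hscale]
  calc _ ≤ (Fintype.card ι : ℝ) ^ (γ / 2) * a j ^ (-γ) *
        (4 * ∏ i ∈ Finset.univ.erase j, (c i * (a i / a j) ^ (-(γ * θ i)))) := by gcongr
    _ = _ := by
      rw [Finset.prod_mul_distrib]
      ring

theorem integrableOn_cubeSlab_rpow {ι : Type*} [Fintype ι] (p : ℝ) (j : ι) {a : ι → ℝ}
    (ha : ∀ i, 0 < a i) :
    IntegrableOn (fun y : ι → ℝ => (∑ i, (a i * y i) ^ 2) ^ p) (cubeSlab j) := by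
  refine ContinuousOn.integrableOn_compact (isCompact_cubeSlab j) ?_
  refine ContinuousOn.rpow_const (by fun_prop) fun y hy => Or.inl ?_
  have hyj : y j ≠ 0 := by
    intro h
    have := hy.2
    simp [h] at this
    linarith
  have hle := Finset.single_le_sum (f := fun i => (a i * y i) ^ 2)
    (fun i _ => sq_nonneg _) (Finset.mem_univ j)
  have : 0 < (a j * y j) ^ 2 := by
    have := (ha j).ne'
    positivity
  exact (this.trans_le hle).ne'

/-- Integration in polar coordinates over the shell `1 ≤ ‖x‖ < 2`. -/
theorem exists_integral_sphereMeasure_eq (n : ℕ) :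
    ∃ V : ℝ, 0 < V ∧ ∀ g : EuclideanSpace ℝ (Fin (n+1)) → ℝ,
      (∫ x : sphere (0 : EuclideanSpace ℝ (Fin (n+1))) 1, g x ∂(sphereMeasure n)) * V =
        ∫ x, g (‖x‖⁻¹ • x) * (Set.Ico (1 : ℝ) 2).indicator 1 ‖x‖ := by
  set S : Set (Set.Ioi (0 : ℝ)) := {r | (r : ℝ) ∈ Set.Ico (1 : ℝ) 2} with hS
  have hSm : MeasurableSet S := measurable_subtype_coe measurableSet_Ico
  refine ⟨(Measure.volumeIoiPow n).real S, ?_, fun g => ?_⟩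
  · have hS' : S = Set.Iio ⟨2, Set.mem_Ioi.2 two_pos⟩ \ Set.Iio ⟨1, Set.mem_Ioi.2 one_pos⟩ := by
      ext r
      simp [hS, ← Subtype.coe_lt_coe, ← Subtype.coe_le_coe]
    have hlt : Measure.volumeIoiPow n (Set.Iio ⟨2, Set.mem_Ioi.2 two_pos⟩) ≠ ⊤ := by
      simp [Measure.volumeIoiPow_apply_Iio]
    rw [hS', measureReal_sdiff (Set.Iio_subset_Iio (by simp [← Subtype.coe_le_coe]))
      measurableSet_Iio hlt]
    simp only [measureReal_def, Measure.volumeIoiPow_apply_Iio]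
    rw [ENNReal.toReal_ofReal (by positivity), ENNReal.toReal_ofReal (by positivity), ← sub_div]
    refine div_pos ?_ (by positivity)
    have : (1 : ℝ) ^ (n + 1) < 2 ^ (n + 1) := pow_lt_pow_left₀ one_lt_two zero_le_one (by simp)
    linarith
  · have hV : (Measure.volumeIoiPow n).real S =
        ∫ r : Set.Ioi (0 : ℝ), (Set.Ico (1 : ℝ) 2).indicator 1 (r : ℝ) ∂(Measure.volumeIoiPow n) := by
      rw [← integral_indicator_one hSm]
      rfl
    have hmp := (volume : Measure
      (EuclideanSpace ℝ (Fin (n+1)))).measurePreserving_homeomorphUnitSphereProd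
    rw [finrank_euclideanSpace_fin, Nat.add_sub_cancel] at hmp
    rw [hV, sphereMeasure, ← integral_prod_mul,
      ← hmp.integral_comp (Homeomorph.measurableEmbedding _)]
    simp only [homeomorphUnitSphereProd_apply_fst_coe, homeomorphUnitSphereProd_apply_snd_coe]
    rw [integral_subtype_comap isOpen_compl_singleton.measurableSet
      (fun x : EuclideanSpace ℝ (Fin (n+1)) =>
        g (‖x‖⁻¹ • x) * (Set.Ico (1 : ℝ) 2).indicator 1 ‖x‖), restrict_compl_singleton]

theorem exists_mem_cubeSlab {n : ℕ} {x : EuclideanSpace ℝ (Fin (n+1))} (h1 : 1 ≤ ‖x‖)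
    (h2 : ‖x‖ ≤ 2) : ∃ j, WithLp.ofLp x ∈ cubeSlab j := by
  have hsq : ‖x‖ ^ 2 = ∑ i, (x i) ^ 2 := by
    rw [EuclideanSpace.real_norm_sq_eq]
  obtain ⟨j, -, hj⟩ := Finset.exists_max_image Finset.univ (fun i => (x i) ^ 2)
    Finset.univ_nonempty
  refine ⟨j, fun i => ?_, ?_⟩
  · have hi := PiLp.norm_apply_le x i
    rw [Real.norm_eq_abs] at hi
    exact abs_le.1 (hi.trans h2)
  · have : ∑ i, (x i) ^ 2 ≤ ∑ i : Fin (n+1), (x j) ^ 2 :=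
      Finset.sum_le_sum fun i hi => hj i hi
    rw [Finset.sum_const, Finset.card_univ, nsmul_eq_mul] at this
    nlinarith

/-- Spherical integrals of negative powers of ellipsoidal norms are controlled by integrals over
slabs of a cube. -/
theorem exists_integral_sphereMeasure_le (n : ℕ) {γ : ℝ} (hγ : 0 < γ) :
    ∃ C : ℝ, 0 ≤ C ∧ ∀ (b : OrthonormalBasis (Fin (n+1)) ℝ (EuclideanSpace ℝ (Fin (n+1))))
      (a : Fin (n+1) → ℝ), (∀ i, 0 < a i) →
      ∫ x : sphere (0 : EuclideanSpace ℝ (Fin (n+1))) 1,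
        (∑ i, (a i * inner ℝ (b i) (x : EuclideanSpace ℝ (Fin (n+1)))) ^ 2) ^ (-(γ / 2))
          ∂(sphereMeasure n) ≤
      C * ∑ j, ∫ y in cubeSlab j, (∑ i, (a i * y i) ^ 2) ^ (-(γ / 2)) := by
  obtain ⟨V, hV, hpolar⟩ := exists_integral_sphereMeasure_eq n
  refine ⟨2 ^ γ / V, by positivity, fun b a ha => ?_⟩
  rw [div_mul_eq_mul_div, le_div_iff₀ hV,
    hpolar (fun x => (∑ i, (a i * inner ℝ (b i) x) ^ 2) ^ (-(γ / 2)))]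
  set h : (Fin (n+1) → ℝ) → ℝ := fun y => (∑ i, (a i * y i) ^ 2) ^ (-(γ / 2)) with hh
  have hnn : ∀ y, 0 ≤ h y := fun y =>
    Real.rpow_nonneg (Finset.sum_nonneg fun i _ => sq_nonneg _) _
  set H : (Fin (n+1) → ℝ) → ℝ := fun y => ∑ j, (cubeSlab j).indicator h y with hH
  have hHint : Integrable H := integrable_finsetSum _ fun j _ =>
    (integrable_indicator_iff (isCompact_cubeSlab j).measurableSet).2
      (integrableOn_cubeSlab_rpow _ j ha)
  have hmp : MeasurePreserving (fun x => WithLp.ofLp (b.repr x)) :=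
    (PiLp.volume_preserving_ofLp (Fin (n+1))).comp b.measurePreserving_repr
  have hemb : MeasurableEmbedding (fun x => WithLp.ofLp (b.repr x)) :=
    (MeasurableEquiv.toLp 2 (Fin (n+1) → ℝ)).symm.measurableEmbedding.comp
      b.measurableEquiv.measurableEmbedding
  have hcoord : ∀ x i, WithLp.ofLp (b.repr x) i = inner ℝ (b i) x := fun x i =>
    b.repr_apply_apply x i
  calc _ ≤ ∫ x, 2 ^ γ * H (WithLp.ofLp (b.repr x)) := by
        refine integral_mono_of_nonneg (.of_forall fun x => mul_nonneg
          (Real.rpow_nonneg (Finset.sum_nonneg fun i _ => sq_nonneg _) _)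
          (Set.indicator_nonneg (fun _ _ => zero_le_one) _))
          (((hmp.integrable_comp_emb hemb).2 hHint).const_mul _) (.of_forall fun x => ?_)
        have hHnn : 0 ≤ H (WithLp.ofLp (b.repr x)) :=
          Finset.sum_nonneg fun j _ => Set.indicator_nonneg (fun y _ => hnn y) _
        by_cases hx : ‖x‖ ∈ Set.Ico (1 : ℝ) 2
        · have hx0 : 0 < ‖x‖ := by linarith [hx.1]
          obtain ⟨j, hj⟩ := exists_mem_cubeSlab (x := b.repr x)
            (by simpa using hx.1) (by simpa using hx.2.le)
          have hle : h (WithLp.ofLp (b.repr x)) ≤ H (WithLp.ofLp (b.repr x)) := by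
            have := Finset.single_le_sum
              (f := fun j => (cubeSlab j).indicator h (WithLp.ofLp (b.repr x)))
              (fun j _ => Set.indicator_nonneg (fun y _ => hnn y) _) (Finset.mem_univ j)
            simpa only [Set.indicator_of_mem hj] using this
          simp only [Set.indicator_of_mem hx, Pi.one_apply, mul_one]
          have hscale : (∑ i, (a i * inner ℝ (b i) (‖x‖⁻¹ • x)) ^ 2) ^ (-(γ / 2)) =
              ‖x‖ ^ γ * h (WithLp.ofLp (b.repr x)) := by
            simp only [hh, hcoord, real_inner_smul_right]
            have : ∀ i, (a i * (‖x‖⁻¹ * inner ℝ (b i) x)) ^ 2 =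
                (‖x‖ ^ 2)⁻¹ * (a i * inner ℝ (b i) x) ^ 2 := fun i => by
              field_simp
            simp only [this]
            rw [← Finset.mul_sum, Real.mul_rpow (by positivity)
              (Finset.sum_nonneg fun i _ => sq_nonneg _), Real.inv_rpow (by positivity),
              Real.rpow_neg (by positivity), inv_inv, ← Real.rpow_natCast, ← Real.rpow_mul hx0.le]
            congr 2
            push_cast
            ring
          rw [hscale]
          exact mul_le_mul (Real.rpow_le_rpow hx0.le hx.2.le hγ.le) hle (hnn _) (by positivity)
        · simp only [Set.indicator_of_notMem hx, mul_zero]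
          positivity
    _ = 2 ^ γ * ∑ j, ∫ y in cubeSlab j, h y := by
        rw [integral_const_mul, hmp.integral_comp hemb H, integral_finsetSum]
        · simp only [integral_indicator (isCompact_cubeSlab _).measurableSet]
        · exact fun j _ => (integrable_indicator_iff (isCompact_cubeSlab j).measurableSet).2
            (integrableOn_cubeSlab_rpow _ j ha)

/-- Singular value decomposition of an injective endomorphism of a Euclidean space. -/
theorem exists_singular_value_decomposition {n : ℕ}
    (T : EuclideanSpace ℝ (Fin (n+1)) →ₗ[ℝ] EuclideanSpace ℝ (Fin (n+1)))
    (hT : Function.Injective T) :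
    ∃ (f b : OrthonormalBasis (Fin (n+1)) ℝ (EuclideanSpace ℝ (Fin (n+1))))
      (a : Fin (n+1) → ℝ), (∀ i, 0 < a i) ∧ ∀ i, T (f i) = a i • b i := by
  have hsymm : (LinearMap.adjoint T * T).IsSymmetric := LinearMap.isSymmetric_adjoint_mul_self T
  have hfr : Module.finrank ℝ (EuclideanSpace ℝ (Fin (n+1))) = n + 1 := finrank_euclideanSpace_fin
  set f := hsymm.eigenvectorBasis hfr with hf
  set ev := hsymm.eigenvalues hfr with hev
  have hinner : ∀ i j, inner ℝ (T (f i)) (T (f j)) = if i = j then ev j else 0 := by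
    intro i j
    rw [← LinearMap.adjoint_inner_right, ← Module.End.mul_apply,
      hsymm.apply_eigenvectorBasis hfr j, inner_smul_right,
      orthonormal_iff_ite.1 f.orthonormal i j]
    simp [hev]
  have hTf : ∀ i, 0 < ‖T (f i)‖ := fun i => norm_pos_iff.2 fun h =>
    f.orthonormal.ne_zero i (hT (by rw [h, map_zero]))
  have hon : Orthonormal ℝ fun i => ‖T (f i)‖⁻¹ • T (f i) := by
    refine ⟨fun i => ?_, fun i j hij => ?_⟩
    · rw [norm_smul, norm_inv, norm_norm, inv_mul_cancel₀ (hTf i).ne']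
    · simp only [inner_smul_left, inner_smul_right, hinner, if_neg hij, mul_zero]
  have hsp : ⊤ ≤ Submodule.span ℝ (Set.range fun i => ‖T (f i)‖⁻¹ • T (f i)) :=
    (hon.linearIndependent.span_eq_top_of_card_eq_finrank (by simp)).ge
  refine ⟨f, OrthonormalBasis.mk hon hsp, fun i => ‖T (f i)‖, hTf, fun i => ?_⟩
  rw [OrthonormalBasis.coe_mk, smul_smul, mul_inv_cancel₀ (hTf i).ne', one_smul]

/-- A simplex of maximal volume with a given interior vertex `v₀` controls the convex body: every
point has coordinates bounded by `1` with respect to its edges at `v₀`. -/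
theorem exists_edges_coord_le_one {n : ℕ} {Ω : Set (EuclideanSpace ℝ (Fin (n+1)))}
    (hΩ : IsCompact Ω) {v₀ : EuclideanSpace ℝ (Fin (n+1))} (hv₀ : v₀ ∈ interior Ω) :
    ∃ w : Module.Basis (Fin (n+1)) ℝ (EuclideanSpace ℝ (Fin (n+1))),
      (∀ i, v₀ + w i ∈ Ω) ∧ ∀ p ∈ Ω, ∀ i, |w.repr (p - v₀) i| ≤ 1 := by
  set e := (EuclideanSpace.basisFun (Fin (n+1)) ℝ).toBasis with he
  set D : (Fin (n+1) → EuclideanSpace ℝ (Fin (n+1))) → ℝ := fun v => |e.det fun i => v i - v₀|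
    with hD
  have hcont : Continuous D := by
    refine Continuous.abs ?_
    simp only [Module.Basis.det_apply]
    refine Continuous.matrix_det (continuous_matrix fun i j => ?_)
    simp only [Module.Basis.toMatrix_apply, he, OrthonormalBasis.coe_toBasis_repr_apply,
      EuclideanSpace.basisFun_repr]
    fun_prop
  obtain ⟨v, hv, hmax⟩ := (isCompact_univ_pi fun _ : Fin (n+1) => hΩ).exists_isMaxOn
    ⟨fun _ => v₀, fun _ _ => interior_subset hv₀⟩ hcont.continuousOn
  have hpos : 0 < D v := by
    obtain ⟨ε, hε, hball⟩ := Metric.isOpen_iff.1 isOpen_interior v₀ hv₀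
    have hmem : (fun i => v₀ + (ε / 2) • e i) ∈ Set.univ.pi fun _ : Fin (n+1) => Ω := by
      intro i _
      refine interior_subset (hball ?_)
      rw [mem_ball, dist_eq_norm, add_sub_cancel_left, norm_smul, he, OrthonormalBasis.coe_toBasis,
        (EuclideanSpace.basisFun (Fin (n+1)) ℝ).norm_eq_one, mul_one, Real.norm_eq_abs,
        abs_of_pos (half_pos hε)]
      linarith
    refine lt_of_lt_of_le ?_ (hmax hmem)
    simp only [hD, add_sub_cancel_left]
    have := e.det.map_smul_univ (fun _ : Fin (n+1) => ε / 2) e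
    rw [this, e.det_self]
    positivity
  have hdet : e.det (fun i => v i - v₀) ≠ 0 := abs_pos.1 hpos
  obtain ⟨hli, hsp⟩ := e.is_basis_iff_det.2 (isUnit_iff_ne_zero.2 hdet)
  refine ⟨Module.Basis.mk hli hsp.ge, fun i => ?_, fun p hp i => ?_⟩
  · rw [Module.Basis.mk_apply, add_sub_cancel]
    exact hv i (Set.mem_univ i)
  · have hcramer := congrArg (fun φ => φ (p - v₀)) (e.det_smul_mk_coord_eq_det_update hli hsp.ge i)
    simp only [LinearMap.smul_apply, smul_eq_mul, Module.Basis.coord_apply,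
      MultilinearMap.toLinearMap_apply, AlternatingMap.coe_multilinearMap] at hcramer
    have hupd : Function.update v i p ∈ Set.univ.pi fun _ : Fin (n+1) => Ω := by
      intro k _
      by_cases hk : k = i
      · subst hk
        simpa using hp
      · simpa [hk] using hv k (Set.mem_univ k)
    have hle := hmax hupd
    have hfun : (fun k => Function.update v i p k - v₀) =
        Function.update (fun k => v k - v₀) i (p - v₀) := by
      ext k : 1
      by_cases hk : k = i
      · subst hk
        simp
      · simp [hk]
    simp only [hD, Set.mem_ofPred_eq, hfun] at hle
    rw [← hcramer, abs_mul] at hle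
    exact le_of_mul_le_mul_left (by simpa using hle) hpos

/-- A simplex with one vertex at `v₀`, described by its edges at `v₀`, lies in any convex set
containing its vertices. -/
theorem Convex.add_sum_smul_mem {E ι : Type*} [AddCommGroup E] [Module ℝ E] [Fintype ι]
    {s : Set E} (hs : Convex ℝ s) {v₀ : E} (hv₀ : v₀ ∈ s) {w : ι → E} (hw : ∀ i, v₀ + w i ∈ s)
    {u : ι → ℝ} (hu : ∀ i, 0 ≤ u i) (hus : ∑ i, u i ≤ 1) : v₀ + ∑ i, u i • w i ∈ s := by
  have := hs.sum_mem (t := (Finset.univ : Finset (Option ι)))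
    (w := fun o => o.elim (1 - ∑ i, u i) u) (z := fun o => o.elim v₀ fun i => v₀ + w i)
    (by rintro (_ | i) - <;> simp [hu, hus]) (by simp [Fintype.sum_option])
    (by rintro (_ | i) - <;> simp [hv₀, hw])
  convert this using 1
  simp only [Fintype.sum_option, Option.elim_none, Option.elim_some, smul_add,
    Finset.sum_add_distrib, ← Finset.sum_smul, sub_smul, one_smul]
  abel

/-- A convex body lies between two homothetic ellipsoids whose ratio depends only on the
dimension. -/
theorem exists_ellipsoid_sandwich (n : ℕ) :
    ∃ κ K : ℝ, 0 < κ ∧ 0 < K ∧ ∀ Ω : Set (EuclideanSpace ℝ (Fin (n+1))),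
      IsCompact Ω → Convex ℝ Ω → (interior Ω).Nonempty →
      ∃ (z : EuclideanSpace ℝ (Fin (n+1)))
        (b : OrthonormalBasis (Fin (n+1)) ℝ (EuclideanSpace ℝ (Fin (n+1))))
        (a : Fin (n+1) → ℝ), (∀ i, 0 < a i) ∧
        (∀ x ∈ Ω, ∑ i, ((a i)⁻¹ * inner ℝ (b i) (x - z)) ^ 2 ≤ K ^ 2) ∧
        ∀ y, ∑ i, ((a i)⁻¹ * inner ℝ (b i) y) ^ 2 ≤ κ ^ 2 → z + y ∈ Ω := by
  refine ⟨1 / ((n + 1) * (n + 2)), 2 * (n + 1), by positivity, by positivity,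
    fun Ω hΩ hconv ⟨v₀, hv₀⟩ => ?_⟩
  obtain ⟨w, hw, hw1⟩ := exists_edges_coord_le_one hΩ hv₀
  set T : EuclideanSpace ℝ (Fin (n+1)) →ₗ[ℝ] EuclideanSpace ℝ (Fin (n+1)) :=
    (EuclideanSpace.basisFun (Fin (n+1)) ℝ).toBasis.constr ℝ w with hTdef
  have hT : ∀ t, T t = ∑ i, t i • w i := fun t => by
    rw [hTdef, Module.Basis.constr_apply_fintype]
    simp
  have hwT : ∀ t i, w.repr (T t) i = t i := fun t i => by
    rw [hT, w.repr_sum_self]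
  have hinj : Function.Injective T := fun s t hst => by
    ext i
    rw [← hwT s, ← hwT t, hst]
  obtain ⟨f, b, a, ha, hfb⟩ := exists_singular_value_decomposition T hinj
  have hcoord : ∀ t i, (a i)⁻¹ * inner ℝ (b i) (T t) = inner ℝ (f i) t := by
    intro t i
    conv_lhs => rw [← f.sum_repr t]
    have hai := (ha i).ne'
    simp only [map_sum, map_smul, hfb, inner_sum, inner_smul_right,
      orthonormal_iff_ite.1 b.orthonormal, mul_ite, mul_one, mul_zero, Finset.sum_ite_eq,
      Finset.mem_univ, if_true, f.repr_apply_apply]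
    field_simp
  have hnorm : ∀ t, ∑ i, ((a i)⁻¹ * inner ℝ (b i) (T t)) ^ 2 = ‖t‖ ^ 2 := fun t => by
    simp only [hcoord]
    exact f.sum_sq_inner_right t
  have hsurj : Function.Surjective T := LinearMap.injective_iff_surjective.1 hinj
  refine ⟨v₀ + ∑ i, (1 / ((n : ℝ) + 2)) • w i, b, a, ha, fun x hx => ?_, fun y hy => ?_⟩
  · obtain ⟨t, ht⟩ := hsurj (x - (v₀ + ∑ i, (1 / ((n : ℝ) + 2)) • w i))
    rw [← ht, hnorm, EuclideanSpace.real_norm_sq_eq]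
    have hti : ∀ i, |t i| ≤ 2 := by
      intro i
      rw [← hwT t i, ht, ← sub_sub, map_sub, Finsupp.coe_sub, Pi.sub_apply,
        w.repr_sum_self fun _ => 1 / ((n : ℝ) + 2)]
      have h1 : |1 / ((n : ℝ) + 2)| ≤ 1 := by
        rw [abs_of_pos (by positivity), div_le_one (by positivity)]
        linarith [(Nat.cast_nonneg n : (0 : ℝ) ≤ n)]
      exact (abs_sub _ _).trans (by linarith [hw1 x hx i])
    calc ∑ i, (t i) ^ 2 ≤ ∑ i : Fin (n+1), (4 : ℝ) := Finset.sum_le_sum fun i _ => by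
          nlinarith [abs_le.1 (hti i)]
      _ ≤ (2 * ((n : ℝ) + 1)) ^ 2 := by
          simp only [Finset.sum_const, Finset.card_univ, Fintype.card_fin, nsmul_eq_mul]
          push_cast
          nlinarith [(Nat.cast_nonneg n : (0 : ℝ) ≤ n)]
  · obtain ⟨t, rfl⟩ := hsurj y
    rw [hnorm] at hy
    have ht : ‖t‖ ≤ 1 / ((n + 1) * (n + 2)) := le_of_sq_le_sq hy (by positivity)
    have hti : ∀ i, |t i| ≤ 1 / ((n + 1) * (n + 2)) := fun i =>
      (PiLp.norm_apply_le t i).trans ht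
    rw [hT, add_assoc, ← Finset.sum_add_distrib]
    simp only [← add_smul]
    refine hconv.add_sum_smul_mem (interior_subset hv₀) hw (fun i => ?_) ?_
    · have h1 : 1 / (((n : ℝ) + 1) * (n + 2)) ≤ 1 / ((n : ℝ) + 2) := by
        refine one_div_le_one_div_of_le (by positivity) ?_
        nlinarith [(Nat.cast_nonneg n : (0 : ℝ) ≤ n)]
      linarith [(abs_le.1 (hti i)).1]
    · calc _ ≤ ∑ i : Fin (n+1), (1 / ((n : ℝ) + 2) + 1 / ((n + 1) * (n + 2))) :=
            Finset.sum_le_sum fun i _ => by linarith [(abs_le.1 (hti i)).2]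
        _ = 1 := by
            simp only [Finset.sum_const, Finset.card_univ, Fintype.card_fin, nsmul_eq_mul]
            push_cast
            field_simp
            ring

theorem sum_sq_mul_inner_pos {n : ℕ}
    (b : OrthonormalBasis (Fin (n+1)) ℝ (EuclideanSpace ℝ (Fin (n+1)))) {a : Fin (n+1) → ℝ}
    (ha : ∀ i, 0 < a i) {x : EuclideanSpace ℝ (Fin (n+1))} (hx : x ≠ 0) :
    0 < ∑ i, (a i * inner ℝ (b i) x) ^ 2 := by
  refine lt_of_le_of_ne (Finset.sum_nonneg fun i _ => sq_nonneg _) fun h => hx ?_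
  have h0 := (Finset.sum_eq_zero_iff_of_nonneg fun i _ => sq_nonneg _).1 h.symm
  refine b.toBasis.ext_elem fun i => ?_
  have hi := pow_eq_zero_iff two_ne_zero |>.1 (h0 i (Finset.mem_univ i))
  simpa [b.repr_apply_apply, (ha i).ne'] using hi

theorem le_mul_rpow_neg_half {l Q K : ℝ} (hK : 0 ≤ K) (hQ : 0 < Q) (h : l ^ 2 * Q ≤ K ^ 2) :
    l ≤ K * Q ^ (-(1 / 2) : ℝ) := by
  rw [Real.rpow_neg hQ.le, ← Real.sqrt_eq_rpow, ← div_eq_mul_inv, le_div_iff₀ (Real.sqrt_pos.2 hQ)]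
  refine le_of_sq_le_sq ?_ hK
  rwa [mul_pow, Real.sq_sqrt hQ.le]

theorem radial_nonneg {n : ℕ} (Ω : Set (EuclideanSpace ℝ (Fin (n+1))))
    (z x : EuclideanSpace ℝ (Fin (n+1))) : 0 ≤ radial Ω z x :=
  Real.sSup_nonneg fun _ hl => hl.1.le

/-- A body inside an ellipsoid has radial function at most that of the ellipsoid. -/
theorem radial_le_of_subset_ellipsoid {n : ℕ} {Ω : Set (EuclideanSpace ℝ (Fin (n+1)))}
    {z : EuclideanSpace ℝ (Fin (n+1))}
    {b : OrthonormalBasis (Fin (n+1)) ℝ (EuclideanSpace ℝ (Fin (n+1)))} {a : Fin (n+1) → ℝ}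
    (ha : ∀ i, 0 < a i) {K : ℝ} (hK : 0 ≤ K)
    (h : ∀ x ∈ Ω, ∑ i, (a i * inner ℝ (b i) (x - z)) ^ 2 ≤ K ^ 2)
    {x : EuclideanSpace ℝ (Fin (n+1))} (hx : x ≠ 0) :
    radial Ω z x ≤ K * (∑ i, (a i * inner ℝ (b i) x) ^ 2) ^ (-(1 / 2) : ℝ) := by
  have hQ := sum_sq_mul_inner_pos b ha hx
  refine Real.sSup_le (fun l hl => le_mul_rpow_neg_half hK hQ ?_)
    (mul_nonneg hK (Real.rpow_nonneg hQ.le _))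
  have := h _ hl.2
  simp only [add_sub_cancel_left, inner_smul_right] at this
  rw [Finset.mul_sum]
  convert this using 2
  ring

/-- The dual of a body containing an ellipsoid has radial function at most that of the dual
ellipsoid. -/
theorem radial_dualBody_le_of_ellipsoid_subset {n : ℕ} {Ω : Set (EuclideanSpace ℝ (Fin (n+1)))}
    {z : EuclideanSpace ℝ (Fin (n+1))}
    {b : OrthonormalBasis (Fin (n+1)) ℝ (EuclideanSpace ℝ (Fin (n+1)))} {a : Fin (n+1) → ℝ}
    (ha : ∀ i, 0 < a i) {κ : ℝ} (hκ : 0 < κ)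
    (h : ∀ y, ∑ i, ((a i)⁻¹ * inner ℝ (b i) y) ^ 2 ≤ κ ^ 2 → z + y ∈ Ω)
    {x : EuclideanSpace ℝ (Fin (n+1))} (hx : x ≠ 0) :
    radial (dualBody Ω z) z x ≤
      κ⁻¹ * (∑ i, (a i * inner ℝ (b i) x) ^ 2) ^ (-(1 / 2) : ℝ) := by
  have hP := sum_sq_mul_inner_pos b ha hx
  set P := ∑ i, (a i * inner ℝ (b i) x) ^ 2 with hPdef
  have hs := Real.sqrt_pos.2 hP
  have hs2 : √P ^ 2 = P := Real.sq_sqrt hP.le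
  refine Real.sSup_le (fun l hl => le_mul_rpow_neg_half (inv_nonneg.2 hκ.le) hP ?_)
    (mul_nonneg (inv_nonneg.2 hκ.le) (Real.rpow_nonneg hP.le _))
  set c := κ / √P with hc
  set y := ∑ i, (c * (a i ^ 2 * inner ℝ (b i) x)) • b i with hy
  have hby : ∀ i, inner ℝ (b i) y = c * (a i ^ 2 * inner ℝ (b i) x) := fun i => by
    simp [hy, inner_sum, inner_smul_right, orthonormal_iff_ite.1 b.orthonormal]
  have hmem : z + y ∈ Ω := by
    refine h y (le_of_eq ?_)
    have : ∀ i, ((a i)⁻¹ * inner ℝ (b i) y) ^ 2 = c ^ 2 * (a i * inner ℝ (b i) x) ^ 2 :=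
      fun i => by
        have := (ha i).ne'
        rw [hby]
        field_simp
    simp only [this]
    rw [← Finset.mul_sum, ← hPdef, hc, div_pow, hs2, div_mul_cancel₀ _ hP.ne']
  have hxy : ∑ i, x i * y i = c * P := by
    have h1 : inner ℝ x y = ∑ i, x i * y i := by
      simp [PiLp.inner_apply, mul_comm]
    rw [← h1, hy, inner_sum, hPdef, Finset.mul_sum]
    refine Finset.sum_congr rfl fun i _ => ?_
    rw [inner_smul_right, real_inner_comm]
    ring
  have hle := hl.2 _ hmem
  have hle' : l * (c * P) ≤ 1 := by
    rw [← hxy, Finset.mul_sum]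
    refine (Finset.sum_congr rfl fun i _ => ?_).trans_le hle
    simp [mul_assoc]
  have hcP : c * P = κ * √P := by
    rw [hc, ← hs2, Real.sqrt_sq hs.le]
    field_simp
  rw [hcP] at hle'
  have hl0 := hl.1
  have hsq : (l * (κ * √P)) ^ 2 ≤ 1 := pow_le_one₀ (by positivity) hle'
  rw [inv_pow, ← one_div, le_div_iff₀ (by positivity)]
  calc l ^ 2 * P * κ ^ 2 = (l * (κ * √P)) ^ 2 := by rw [mul_pow, mul_pow, hs2]; ring
    _ ≤ 1 := hsq

theorem mem_interior_of_ellipsoid_subset {n : ℕ} {Ω : Set (EuclideanSpace ℝ (Fin (n+1)))}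
    {z : EuclideanSpace ℝ (Fin (n+1))}
    {b : OrthonormalBasis (Fin (n+1)) ℝ (EuclideanSpace ℝ (Fin (n+1)))} {a : Fin (n+1) → ℝ}
    {κ : ℝ} (hκ : 0 < κ)
    (h : ∀ y, ∑ i, (a i * inner ℝ (b i) y) ^ 2 ≤ κ ^ 2 → z + y ∈ Ω) : z ∈ interior Ω := by
  have hopen : IsOpen {p | ∑ i, (a i * inner ℝ (b i) (p - z)) ^ 2 < κ ^ 2} :=
    isOpen_lt (by fun_prop) continuous_const
  refine mem_interior.2 ⟨_, fun p hp => ?_, hopen, ?_⟩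
  · simpa using h (p - z) (le_of_lt hp)
  · simpa using pow_pos hκ 2

/-- The `L^γ` norm on the sphere of a function dominated by the radial function of an ellipsoid is
controlled by the integral over one of the slabs. -/
theorem exists_integral_rpow_le_cubeSlab (n : ℕ) {γ : ℝ} (hγ : 0 < γ) {R : ℝ} (hR : 0 ≤ R) :
    ∃ C : ℝ, 0 ≤ C ∧ ∀ (b : OrthonormalBasis (Fin (n+1)) ℝ (EuclideanSpace ℝ (Fin (n+1))))
      (a : Fin (n+1) → ℝ), (∀ i, 0 < a i) → ∃ j, ∀ ρ : EuclideanSpace ℝ (Fin (n+1)) → ℝ,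
      (∀ x, 0 ≤ ρ x) →
      (∀ x, x ≠ 0 → ρ x ≤ R * (∑ i, (a i * inner ℝ (b i) x) ^ 2) ^ (-(1 / 2) : ℝ)) →
      ∫ x : sphere (0 : EuclideanSpace ℝ (Fin (n+1))) 1, ρ x ^ γ ∂(sphereMeasure n) ≤
      C * ∫ y in cubeSlab j, (∑ i, (a i * y i) ^ 2) ^ (-(γ / 2)) := by
  obtain ⟨C, hC, hbound⟩ := exists_integral_sphereMeasure_le n hγ
  refine ⟨R ^ γ * (C * (n + 1)), by positivity, fun b a ha => ?_⟩
  obtain ⟨j, -, hj⟩ := Finset.exists_max_image Finset.univ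
    (fun j => ∫ y in cubeSlab j, (∑ i, (a i * y i) ^ 2) ^ (-(γ / 2))) Finset.univ_nonempty
  refine ⟨j, fun ρ hρ0 hρ => ?_⟩
  have hne : ∀ x : sphere (0 : EuclideanSpace ℝ (Fin (n+1))) 1,
      (x : EuclideanSpace ℝ (Fin (n+1))) ≠ 0 := fun x => ne_zero_of_mem_unit_sphere x
  have hint : Integrable (fun x : sphere (0 : EuclideanSpace ℝ (Fin (n+1))) 1 =>
      (∑ i, (a i * inner ℝ (b i) (x : EuclideanSpace ℝ (Fin (n+1)))) ^ 2) ^ (-(γ / 2)))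
      (sphereMeasure n) := by
    have : IsFiniteMeasure (sphereMeasure n) := by
      unfold sphereMeasure
      infer_instance
    refine Continuous.integrable_of_hasCompactSupport ?_ (HasCompactSupport.of_compactSpace _)
    exact Continuous.rpow_const (by fun_prop) fun x =>
      Or.inl (sum_sq_mul_inner_pos b ha (hne x)).ne'
  calc _ ≤ ∫ x : sphere (0 : EuclideanSpace ℝ (Fin (n+1))) 1, R ^ γ *
        (∑ i, (a i * inner ℝ (b i) (x : EuclideanSpace ℝ (Fin (n+1)))) ^ 2) ^ (-(γ / 2))
          ∂(sphereMeasure n) := by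
        refine integral_mono_of_nonneg (.of_forall fun x => Real.rpow_nonneg (hρ0 x) _)
          (hint.const_mul _) (.of_forall fun x => ?_)
        have hQ := sum_sq_mul_inner_pos b ha (hne x)
        refine (Real.rpow_le_rpow (hρ0 x) (hρ x (hne x)) hγ.le).trans_eq ?_
        rw [Real.mul_rpow hR (Real.rpow_nonneg hQ.le _), ← Real.rpow_mul hQ.le]
        congr 2
        ring
    _ ≤ R ^ γ * (C * ∑ j, ∫ y in cubeSlab j, (∑ i, (a i * y i) ^ 2) ^ (-(γ / 2))) := by
        rw [integral_const_mul]
        exact mul_le_mul_of_nonneg_left (hbound b a ha) (by positivity)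
    _ ≤ R ^ γ * (C * ((n + 1) *
          ∫ y in cubeSlab j, (∑ i, (a i * y i) ^ 2) ^ (-(γ / 2)))) := by
        have := Finset.sum_le_card_nsmul Finset.univ _ _ hj
        simp only [Finset.card_univ, Fintype.card_fin, nsmul_eq_mul] at this
        push_cast at this
        gcongr
    _ = _ := by ring

/-- The weights balancing the monomial bounds for a pair of slabs. -/
theorem exists_balanced_weights {n : ℕ} (hn : 1 ≤ n) {α β : ℝ} (hα : 0 < α) (hβ : 0 < β)
    (h1 : (n : ℝ) / α + 1 / β ≥ 1) (h2 : 1 / α + (n : ℝ) / β ≥ 1) (j k : Fin (n+1)) :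
    ∃ φ : Fin (n+1) → ℝ, (∀ i, 0 ≤ φ i) ∧ ∑ i, φ i = 1 ∧ 0 < φ j ∧ 0 < φ k ∧
      (∀ i, i ≠ j → α * φ i ≤ 1) ∧ ∀ i, i ≠ k → β * φ i ≤ 1 := by
  by_cases hjk : j = k
  · subst hjk
    refine ⟨Pi.single j 1, fun i => ?_, by simp, by simp, by simp,
      fun i hi => by simp [hi], fun i hi => by simp [hi]⟩
    by_cases hi : i = j
    · subst hi
      simp
    · simp [hi]
  · set m := min (1 / α) (1 / β) with hm
    have hm0 : 0 < m := lt_min (by positivity) (by positivity)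
    set c : Fin (n+1) → ℝ := fun i => if i = j then 1 / β else if i = k then 1 / α else m with hc
    have hc0 : ∀ i, 0 < c i := fun i => by
      simp only [hc]
      split_ifs <;> positivity
    have hcj : c j = 1 / β := by simp [hc]
    have hck : c k = 1 / α := by simp [hc, Ne.symm hjk]
    have hsum : 1 ≤ ∑ i, c i := by
      have hkj : k ∈ Finset.univ.erase j := by simp [Ne.symm hjk]
      rw [← Finset.add_sum_erase _ _ (Finset.mem_univ j), ← Finset.add_sum_erase _ _ hkj, hcj, hck]
      have hrest : ∑ i ∈ (Finset.univ.erase j).erase k, c i = (n - 1 : ℝ) * m := by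
        have : ∀ i ∈ (Finset.univ.erase j).erase k, c i = m := fun i hi => by
          simp only [Finset.mem_erase, Finset.mem_univ, and_true] at hi
          simp [hc, hi.1, hi.2]
        rw [Finset.sum_congr rfl this, Finset.sum_const, nsmul_eq_mul,
          Finset.card_erase_of_mem hkj, Finset.card_erase_of_mem (Finset.mem_univ j)]
        simp [Nat.cast_sub hn]
      rw [hrest]
      rcases min_choice (1 / α) (1 / β) with h | h
      · rw [hm, h]
        have : (n : ℝ) / α + 1 / β = 1 / β + (1 / α + (n - 1) * (1 / α)) := by ring
        linarith
      · rw [hm, h]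
        have : 1 / α + (n : ℝ) / β = 1 / β + (1 / α + (n - 1) * (1 / β)) := by ring
        linarith
    have hs0 : 0 < ∑ i, c i := by linarith
    have hle : ∀ i, c i / ∑ i, c i ≤ c i := fun i => div_le_self (hc0 i).le hsum
    refine ⟨fun i => c i / ∑ i, c i, fun i => (div_pos (hc0 i) hs0).le, ?_,
      div_pos (hc0 j) hs0, div_pos (hc0 k) hs0, fun i hi => ?_, fun i hi => ?_⟩
    · rw [← Finset.sum_div, div_self hs0.ne']
    · have : c i ≤ 1 / α := by
        simp only [hc, if_neg hi]
        split_ifs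
        · exact le_rfl
        · exact min_le_left _ _
      calc α * (c i / ∑ i, c i) ≤ α * (1 / α) :=
          mul_le_mul_of_nonneg_left ((hle i).trans this) hα.le
        _ = 1 := by field_simp
    · have : c i ≤ 1 / β := by
        simp only [hc, if_neg hi]
        split_ifs
        · exact le_rfl
        · exact min_le_right _ _
      calc β * (c i / ∑ i, c i) ≤ β * (1 / β) :=
          mul_le_mul_of_nonneg_left ((hle i).trans this) hβ.le
        _ = 1 := by field_simp

theorem rpow_one_div_le_mul_prod {ι : Type*} [Fintype ι] {γ A C : ℝ} (hγ : 0 < γ) (hA : 0 ≤ A)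
    (hC : 0 ≤ C) {a θ : ι → ℝ} (ha : ∀ i, 0 < a i) (h : A ≤ C * ∏ i, a i ^ (-(γ * θ i))) :
    A ^ (1 / γ) ≤ C ^ (1 / γ) * ∏ i, a i ^ (-θ i) := by
  refine (Real.rpow_le_rpow hA h (by positivity)).trans_eq ?_
  have hp : ∀ i ∈ Finset.univ, 0 ≤ a i ^ (-(γ * θ i)) := fun i _ => Real.rpow_nonneg (ha i).le _
  rw [Real.mul_rpow hC (Finset.prod_nonneg hp), ← Real.finsetProd_rpow _ _ hp]
  congr 1
  refine Finset.prod_congr rfl fun i _ => ?_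
  rw [← Real.rpow_mul (ha i).le]
  congr 1
  field_simp

/-- The generalised Blaschke–Santaló inequality. -/
theorem generalized_blaschke_santalo (n : ℕ) (hn : 1 ≤ n) (α β : ℝ)
    (hα : 0 < α) (hβ : 0 < β)
    (h1 : (n : ℝ) / α + 1 / β ≥ 1) (h2 : 1 / α + (n : ℝ) / β ≥ 1) :
    ∃ C : ℝ, ∀ Ω : Set (EuclideanSpace ℝ (Fin (n+1))),
      IsCompact Ω → Convex ℝ Ω → (interior Ω).Nonempty →
      ∃ z ∈ interior Ω,
        (∫ x : sphere (0 : EuclideanSpace ℝ (Fin (n+1))) 1,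
            radial Ω z ↑x ^ α ∂(sphereMeasure n)) ^ (1/α) *
        (∫ x : sphere (0 : EuclideanSpace ℝ (Fin (n+1))) 1,
            radial (dualBody Ω z) z ↑x ^ β ∂(sphereMeasure n)) ^ (1/β) ≤ C := by
  obtain ⟨κ, K, hκ, hK, hsandwich⟩ := exists_ellipsoid_sandwich n
  obtain ⟨A, hA, hAbound⟩ := exists_integral_rpow_le_cubeSlab n hα hK.le
  obtain ⟨B, hB, hBbound⟩ := exists_integral_rpow_le_cubeSlab n hβ (inv_nonneg.2 hκ.le)
  choose φ hφ0 hφs hφj hφk hφα hφβ using exists_balanced_weights hn hα hβ h1 h2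
  choose P hP hPbound using fun j k =>
    exists_setIntegral_cubeSlab_le hα (hφ0 j k) (hφs j k) (hφj j k) (hφα j k)
  choose Q hQ hQbound using fun j k =>
    exists_setIntegral_cubeSlab_le hβ (hφ0 j k) (hφs j k) (hφk j k) (hφβ j k)
  set G : Fin (n+1) × Fin (n+1) → ℝ := fun q =>
    (A * P q.1 q.2) ^ (1 / α) * (B * Q q.1 q.2) ^ (1 / β) with hG
  have hG0 : ∀ q, 0 ≤ G q := fun q => by
    have := hP q.1 q.2
    have := hQ q.1 q.2
    positivity
  refine ⟨∑ q, G q, fun Ω hΩ hconv hint => ?_⟩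
  obtain ⟨z, b, a, ha, hout, hin⟩ := hsandwich Ω hΩ hconv hint
  have ha' : ∀ i, 0 < (a i)⁻¹ := fun i => inv_pos.2 (ha i)
  refine ⟨z, mem_interior_of_ellipsoid_subset hκ hin, ?_⟩
  obtain ⟨j, hj⟩ := hAbound b _ ha'
  obtain ⟨k, hk⟩ := hBbound b a ha
  have hI := (hj _ (radial_nonneg Ω z) fun x hx =>
    radial_le_of_subset_ellipsoid ha' hK.le hout hx).trans
      (mul_le_mul_of_nonneg_left (hPbound j k _ ha') hA)
  have hJ := (hk _ (radial_nonneg (dualBody Ω z) z) fun x hx =>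
    radial_dualBody_le_of_ellipsoid_subset ha hκ hin hx).trans
      (mul_le_mul_of_nonneg_left (hQbound j k _ ha) hB)
  rw [← mul_assoc] at hI hJ
  have hI' := rpow_one_div_le_mul_prod hα
    (integral_nonneg fun x => Real.rpow_nonneg (radial_nonneg Ω z _) _)
    (mul_nonneg hA (hP j k)) ha' hI
  have hJ' := rpow_one_div_le_mul_prod hβ
    (integral_nonneg fun x => Real.rpow_nonneg (radial_nonneg (dualBody Ω z) z _) _)
    (mul_nonneg hB (hQ j k)) ha hJ
  have hcancel : (∏ i, (a i)⁻¹ ^ (-φ j k i)) * ∏ i, a i ^ (-φ j k i) = 1 := by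
    rw [← Finset.prod_mul_distrib]
    refine Finset.prod_eq_one fun i _ => ?_
    rw [← Real.mul_rpow (ha' i).le (ha i).le, inv_mul_cancel₀ (ha i).ne', Real.one_rpow]
  calc _ ≤ ((A * P j k) ^ (1 / α) * ∏ i, (a i)⁻¹ ^ (-φ j k i)) *
        ((B * Q j k) ^ (1 / β) * ∏ i, a i ^ (-φ j k i)) :=
        mul_le_mul hI' hJ' (Real.rpow_nonneg (integral_nonneg fun x =>
          Real.rpow_nonneg (radial_nonneg (dualBody Ω z) z _) _) _)
          (mul_nonneg (Real.rpow_nonneg (mul_nonneg hA (hP j k)) _)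
            (Finset.prod_nonneg fun i _ => Real.rpow_nonneg (ha' i).le _))
    _ = G (j, k) := by
        rw [mul_mul_mul_comm, hcancel, mul_one]
    _ ≤ ∑ q, G q := Finset.single_le_sum (fun q _ => hG0 q) (Finset.mem_univ _)
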